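/- Let h : ℝ^d × (0,∞) → ℝ be smooth with h > 0 and q : ℝ^d × (0,∞) → ℝ^d smooth, v := q/h. Then (h, q) solves the dispersive Serre–Green–Naghdi model with topography if and only if there exist smooth scalar functions q₁, q₂, q₃ such that (h, q, q₁, q₂, q₃) solves the quasilinear first-order system ∂_t h + div q = 0; ∂_t q + div(v ⊗ q) + ∇((1/2)g h² − (1/3) h s) = −(g h − (1/2)s + (1/4)ts)∇z with ts := ∂_t q₃ + div(v q₃) and s := −(∂_t q₂ + div(v q₂)); ∂_t q₁ + div(v q₁) = q₂ − (3/2) q₃; and the state remains on the co-dimension-2 manifold {(h, q, q₁, q₂, q₃) : q₁ = h², q₃ = q·∇z}. -/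

import Mathlib

noncomputable section
open scoped BigOperators

/-- Physical space `ℝ^d`. -/
abbrev Spc (d : ℕ) := EuclideanSpace ℝ (Fin d)
/-- Space-time `ℝ^d × ℝ` (time is the second component). -/
abbrev SpT (d : ℕ) := Spc d × ℝ

/-- Time derivative `∂_t f`. -/
noncomputable def dT {d : ℕ} (f : SpT d → ℝ) (p : SpT d) : ℝ :=
  deriv (fun t => f (p.1, t)) p.2

/-- `i`-th spatial partial derivative `∂_i f` of a space-time function. -/
noncomputable def dX {d : ℕ} (i : Fin d) (f : SpT d → ℝ) (p : SpT d) : ℝ :=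
  fderiv ℝ (fun x => f (x, p.2)) p.1 (EuclideanSpace.single i 1)

/-- `i`-th spatial partial derivative `∂_i z` of a time-independent function. -/
noncomputable def dZ {d : ℕ} (i : Fin d) (z : Spc d → ℝ) (x : Spc d) : ℝ :=
  fderiv ℝ z x (EuclideanSpace.single i 1)

/-- Divergence `div u = ∑_i ∂_i u_i` of a vector field. -/
noncomputable def divF {d : ℕ} (u : SpT d → Spc d) (p : SpT d) : ℝ :=
  ∑ i, dX i (fun q => u q i) p

/-- Divergence `div (f v) = ∑_i ∂_i (v_i f)` of a scalar multiple of a vector field. -/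
noncomputable def divSV {d : ℕ} (v : SpT d → Spc d) (f : SpT d → ℝ) (p : SpT d) : ℝ :=
  ∑ i, dX i (fun q => v q i * f q) p

/-- Advection term `v·∇f`. -/
noncomputable def adv {d : ℕ} (v : SpT d → Spc d) (f : SpT d → ℝ) (p : SpT d) : ℝ :=
  ∑ i, v p i * dX i f p

/-- `v·∇z` for the (time-independent) bathymetry `z`. -/
noncomputable def advZ {d : ℕ} (v : SpT d → Spc d) (z : Spc d → ℝ) (p : SpT d) : ℝ :=
  ∑ i, v p i * dZ i z p.1

theorem dT_eq_fderiv {d : ℕ} {f : SpT d → ℝ} {p : SpT d} (hf : DifferentiableAt ℝ f p) :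
    dT f p = fderiv ℝ f p (0, 1) := by
  have hc : HasDerivAt (fun t : ℝ => (p.1, t)) ((0 : Spc d), (1 : ℝ)) p.2 :=
    (hasDerivAt_const p.2 p.1).prodMk (hasDerivAt_id p.2)
  exact (hf.hasFDerivAt.comp_hasDerivAt p.2 hc).deriv

theorem dX_eq_fderiv {d : ℕ} (i : Fin d) {f : SpT d → ℝ} {p : SpT d}
    (hf : DifferentiableAt ℝ f p) :
    dX i f p = fderiv ℝ f p (EuclideanSpace.single i 1, 0) := by
  have hf' : HasFDerivAt f (fderiv ℝ f p) (p.1, p.2) := hf.hasFDerivAt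
  have hc := HasFDerivAt.comp p.1 hf' (hasFDerivAt_prodMk_left (𝕜 := ℝ) p.1 p.2)
  have he : fderiv ℝ (fun x => f (x, p.2)) p.1 = _ := hc.fderiv
  simp [dX, he]

theorem contDiff_dT {d : ℕ} {f : SpT d → ℝ} (hf : ContDiff ℝ (⊤ : ℕ∞) f) :
    ContDiff ℝ (⊤ : ℕ∞) (dT f) := by
  have he : dT f = fun p => fderiv ℝ f p (0, 1) :=
    funext fun p => dT_eq_fderiv (hf.differentiable (by simp) p)
  rw [he]
  exact (hf.fderiv_right (m := (⊤ : ℕ∞)) (by simp)).clm_apply contDiff_const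

theorem contDiff_dX {d : ℕ} (i : Fin d) {f : SpT d → ℝ} (hf : ContDiff ℝ (⊤ : ℕ∞) f) :
    ContDiff ℝ (⊤ : ℕ∞) (dX i f) := by
  have he : dX i f = fun p => fderiv ℝ f p (EuclideanSpace.single i 1, 0) :=
    funext fun p => dX_eq_fderiv i (hf.differentiable (by simp) p)
  rw [he]
  exact (hf.fderiv_right (m := (⊤ : ℕ∞)) (by simp)).clm_apply contDiff_const

theorem contDiff_dZ {d : ℕ} (i : Fin d) {z : Spc d → ℝ} (hz : ContDiff ℝ (⊤ : ℕ∞) z) :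
    ContDiff ℝ (⊤ : ℕ∞) (dZ i z) :=
  (hz.fderiv_right (m := (⊤ : ℕ∞)) (by simp)).clm_apply contDiff_const

theorem contDiff_adv {d : ℕ} {v : SpT d → Spc d} {f : SpT d → ℝ}
    (hv : ContDiff ℝ (⊤ : ℕ∞) v) (hf : ContDiff ℝ (⊤ : ℕ∞) f) :
    ContDiff ℝ (⊤ : ℕ∞) (adv v f) :=
  ContDiff.sum fun i _ => (contDiff_euclidean.1 hv i).mul (contDiff_dX i hf)

theorem contDiff_advZ {d : ℕ} {v : SpT d → Spc d} {z : Spc d → ℝ}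
    (hv : ContDiff ℝ (⊤ : ℕ∞) v) (hz : ContDiff ℝ (⊤ : ℕ∞) z) :
    ContDiff ℝ (⊤ : ℕ∞) (advZ v z) :=
  ContDiff.sum fun i _ => (contDiff_euclidean.1 hv i).mul ((contDiff_dZ i hz).comp contDiff_fst)

theorem dT_add {d : ℕ} {f k : SpT d → ℝ} {p : SpT d}
    (hf : DifferentiableAt ℝ f p) (hk : DifferentiableAt ℝ k p) :
    dT (fun q => f q + k q) p = dT f p + dT k p := by
  rw [dT_eq_fderiv hf, dT_eq_fderiv hk, dT_eq_fderiv (hf.fun_add hk), fderiv_fun_add hf hk]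
  rfl

theorem dX_add {d : ℕ} (i : Fin d) {f k : SpT d → ℝ} {p : SpT d}
    (hf : DifferentiableAt ℝ f p) (hk : DifferentiableAt ℝ k p) :
    dX i (fun q => f q + k q) p = dX i f p + dX i k p := by
  rw [dX_eq_fderiv i hf, dX_eq_fderiv i hk, dX_eq_fderiv i (hf.fun_add hk), fderiv_fun_add hf hk]
  rfl

theorem dT_mul {d : ℕ} {f k : SpT d → ℝ} {p : SpT d}
    (hf : DifferentiableAt ℝ f p) (hk : DifferentiableAt ℝ k p) :
    dT (fun q => f q * k q) p = f p * dT k p + k p * dT f p := by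
  rw [dT_eq_fderiv hf, dT_eq_fderiv hk, dT_eq_fderiv (hf.fun_mul hk), fderiv_fun_mul hf hk]
  rfl

theorem dX_mul {d : ℕ} (i : Fin d) {f k : SpT d → ℝ} {p : SpT d}
    (hf : DifferentiableAt ℝ f p) (hk : DifferentiableAt ℝ k p) :
    dX i (fun q => f q * k q) p = f p * dX i k p + k p * dX i f p := by
  rw [dX_eq_fderiv i hf, dX_eq_fderiv i hk, dX_eq_fderiv i (hf.fun_mul hk), fderiv_fun_mul hf hk]
  rfl

theorem dT_const_mul {d : ℕ} (c : ℝ) (f : SpT d → ℝ) (p : SpT d) :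
    dT (fun q => c * f q) p = c * dT f p :=
  deriv_const_mul_field c

theorem dX_const_mul {d : ℕ} (i : Fin d) (c : ℝ) {f : SpT d → ℝ} {p : SpT d}
    (hf : DifferentiableAt ℝ f p) : dX i (fun q => c * f q) p = c * dX i f p := by
  rw [dX_eq_fderiv i hf, dX_eq_fderiv i (hf.const_mul c), fderiv_const_mul hf]
  rfl

/-- The material derivative `∂_t + v·∇` is linear. -/
theorem material_add_const_mul {d : ℕ} (v : SpT d → Spc d) (c : ℝ) {f k : SpT d → ℝ} {p : SpT d}
    (hf : DifferentiableAt ℝ f p) (hk : DifferentiableAt ℝ k p) :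
    dT (fun q => f q + c * k q) p + adv v (fun q => f q + c * k q) p
      = dT f p + adv v f p + c * (dT k p + adv v k p) := by
  rw [dT_add hf (hk.const_mul c), dT_const_mul]
  simp only [adv, dX_add _ hf (hk.const_mul c), dX_const_mul _ c hk, mul_add, Finset.sum_add_distrib,
    Finset.mul_sum, mul_left_comm c]
  ring

/-- Conservation of mass turns the conservative derivative of `h φ` into `h` times the
material derivative of `φ`. -/
theorem dT_add_divSV_mul_of_mass {d : ℕ} {h φ : SpT d → ℝ} {Q v : SpT d → Spc d} {p : SpT d}
    (hQ : ∀ q i, h q * v q i = Q q i) (hh : DifferentiableAt ℝ h p)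
    (hQd : ∀ i, DifferentiableAt ℝ (fun q => Q q i) p) (hφ : DifferentiableAt ℝ φ p)
    (mass : dT h p + divF Q p = 0) :
    dT (fun q => h q * φ q) p + divSV v (fun q => h q * φ q) p
      = h p * (dT φ p + adv v φ p) := by
  have hdiv : divSV v (fun q => h q * φ q) p = h p * adv v φ p + φ p * divF Q p := by
    simp only [divSV, adv, divF, Finset.mul_sum, ← Finset.sum_add_distrib]
    refine Finset.sum_congr rfl fun i _ => ?_
    have he : (fun q => v q i * (h q * φ q)) = fun q => Q q i * φ q := by
      funext q
      rw [← hQ]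
      ring
    rw [he, dX_mul i (hQd i) hφ, ← hQ]
    ring
  rw [hdiv, dT_mul hh hφ]
  linear_combination φ p * mass

theorem dT_congr_of_pos {d : ℕ} {f k : SpT d → ℝ} (hfk : ∀ q : SpT d, 0 < q.2 → f q = k q)
    {p : SpT d} (hp : 0 < p.2) : dT f p = dT k p := by
  refine Filter.EventuallyEq.deriv_eq ?_
  filter_upwards [lt_mem_nhds hp] with t ht using hfk (p.1, t) ht

theorem dX_congr_of_pos {d : ℕ} (i : Fin d) {f k : SpT d → ℝ}
    (hfk : ∀ q : SpT d, 0 < q.2 → f q = k q)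
    {p : SpT d} (hp : 0 < p.2) : dX i f p = dX i k p := by
  have he : (fun x => f (x, p.2)) = fun x => k (x, p.2) := funext fun x => hfk (x, p.2) hp
  simp only [dX, he]

theorem divSV_congr_of_pos {d : ℕ} (v : SpT d → Spc d) {f k : SpT d → ℝ}
    (hfk : ∀ q : SpT d, 0 < q.2 → f q = k q)
    {p : SpT d} (hp : 0 < p.2) : divSV v f p = divSV v k p :=
  Finset.sum_congr rfl fun i _ =>
    dX_congr_of_pos i (fun q hq => congrArg (v q i * ·) (hfk q hq)) hp

/-- **Co-dimension 2.** `(h, q)` solves the dispersive Serre--Green--Naghdi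
model with topography iff there exist smooth `q₁, q₂, q₃` such that `(h, q, q₁, q₂, q₃)`
solves the quasilinear first-order system on the co-dimension-2 manifold
`{q₁ = h², q₃ = q·∇z}`. -/
theorem sgn_codimension_two_equivalence
    {d : ℕ} (g : ℝ) (hg : 0 < g)
    (z : Spc d → ℝ) (zsm : ContDiff ℝ (⊤ : ℕ∞) z)
    (h : SpT d → ℝ) (Q : SpT d → Spc d)
    (hsm : ContDiff ℝ (⊤ : ℕ∞) h) (Qsm : ContDiff ℝ (⊤ : ℕ∞) Q)
    (hpos : ∀ p : SpT d, 0 < h p)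
    (v : SpT d → Spc d) (hv : ∀ p, v p = (h p)⁻¹ • Q p)
    -- material derivatives, pressure and source of the Serre--Green--Naghdi model
    (hdot : SpT d → ℝ) (hhdot : ∀ p, hdot p = dT h p + adv v h p)
    (hddot : SpT d → ℝ) (hhddot : ∀ p, hddot p = dT hdot p + adv v hdot p)
    (kdot : SpT d → ℝ)
    (hkdot : ∀ p, kdot p = dT (fun q => advZ v z q) p + adv v (fun q => advZ v z q) p)
    (P : SpT d → ℝ)
    (hP : ∀ p, P p = (1/2) * g * (h p)^2 + (h p)^2 * ((1/3) * hddot p + (1/2) * kdot p))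
    (R : SpT d → ℝ)
    (hR : ∀ p, R p = g * h p + h p * ((1/2) * hddot p + kdot p)) :
    -- `(h, q)` solves the Serre--Green--Naghdi model on `ℝ^d × (0,∞)` ...
    ((∀ p : SpT d, 0 < p.2 → dT h p + divF Q p = 0) ∧
     (∀ p : SpT d, 0 < p.2 → ∀ i : Fin d,
       dT (fun q => Q q i) p + (∑ j, dX j (fun q => v q j * Q q i) p)
         + dX i P p + R p * dZ i z p.1 = 0))
    ↔
    -- ... iff there are smooth `q₁, q₂, q₃` solving the first-order system
    -- on the co-dimension-2 manifold `{q₁ = h², q₃ = q·∇z}`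
    (∃ q₁ q₂ q₃ : SpT d → ℝ,
      ContDiff ℝ (⊤ : ℕ∞) q₁ ∧ ContDiff ℝ (⊤ : ℕ∞) q₂ ∧ ContDiff ℝ (⊤ : ℕ∞) q₃ ∧
      (∀ p : SpT d, 0 < p.2 → dT h p + divF Q p = 0) ∧
      (∀ p : SpT d, 0 < p.2 → ∀ i : Fin d,
        dT (fun q => Q q i) p + (∑ j, dX j (fun q => v q j * Q q i) p)
          + dX i (fun q => (1/2) * g * (h q)^2
              - (1/3) * h q * (-(dT q₂ q + divSV v q₂ q))) p
          + (g * h p - (1/2) * (-(dT q₂ p + divSV v q₂ p))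
              + (1/4) * (dT q₃ p + divSV v q₃ p)) * dZ i z p.1 = 0) ∧
      (∀ p : SpT d, 0 < p.2 → dT q₁ p + divSV v q₁ p = q₂ p - (3/2) * q₃ p) ∧
      (∀ p : SpT d, q₁ p = (h p)^2) ∧
      (∀ p : SpT d, q₃ p = ∑ i, Q p i * dZ i z p.1)) := by
  have hQ : ∀ q i, h q * v q i = Q q i := fun q i => by
    simp [hv, mul_inv_cancel_left₀ (hpos q).ne']
  have vsm : ContDiff ℝ (⊤ : ℕ∞) v := by
    rw [funext hv]
    exact (hsm.inv fun p => (hpos p).ne').smul Qsm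
  have hdsm : ContDiff ℝ (⊤ : ℕ∞) hdot := by
    rw [funext hhdot]
    exact (contDiff_dT hsm).add (contDiff_adv vsm hsm)
  have ksm := contDiff_advZ vsm zsm
  have hsmd := hsm.differentiable (by simp)
  have hdsmd := hdsm.differentiable (by simp)
  have ksmd := ksm.differentiable (by simp)
  have Qd : ∀ p i, DifferentiableAt ℝ (fun q => Q q i) p := fun p i =>
    (contDiff_euclidean.1 Qsm i).differentiable (by simp) p
  have hQz : ∀ p, ∑ i, Q p i * dZ i z p.1 = h p * advZ v z p := fun p => by
    simp only [advZ, Finset.mul_sum, ← hQ, mul_assoc]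
  have conserv : (∀ p : SpT d, 0 < p.2 → dT h p + divF Q p = 0) → ∀ f φ : SpT d → ℝ,
      (∀ p : SpT d, 0 < p.2 → f p = h p * φ p) → Differentiable ℝ φ → ∀ p : SpT d, 0 < p.2 →
      dT f p + divSV v f p = h p * (dT φ p + adv v φ p) := by
    intro mass f φ hf hφ p hp
    rw [dT_congr_of_pos hf hp, divSV_congr_of_pos v hf hp]
    exact dT_add_divSV_mul_of_mass hQ (hsmd p) (Qd p) (hφ p) (mass p hp)
  have momentum : (∀ p : SpT d, 0 < p.2 → dT h p + divF Q p = 0) → ∀ q₂ q₃ : SpT d → ℝ,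
      (∀ p : SpT d, 0 < p.2 → q₂ p = h p * (hdot p + 3 / 2 * advZ v z p)) →
      (∀ p : SpT d, q₃ p = ∑ i, Q p i * dZ i z p.1) → ∀ p : SpT d, 0 < p.2 → ∀ i : Fin d,
      dX i (fun q => (1/2) * g * (h q)^2
              - (1/3) * h q * (-(dT q₂ q + divSV v q₂ q))) p
          + (g * h p - (1/2) * (-(dT q₂ p + divSV v q₂ p))
              + (1/4) * (dT q₃ p + divSV v q₃ p)) * dZ i z p.1
        = dX i P p + R p * dZ i z p.1 := by
    intro mass q₂ q₃ h₂ h₃ p hp i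
    have e₂ : ∀ q : SpT d, 0 < q.2 →
        dT q₂ q + divSV v q₂ q = h q * (hddot q + 3 / 2 * kdot q) := fun q hq => by
      rw [conserv mass q₂ _ h₂ (hdsmd.fun_add (ksmd.const_mul _)) q hq,
        material_add_const_mul v _ (hdsmd q) (ksmd q), hhddot, hkdot]
    have e₃ : dT q₃ p + divSV v q₃ p = h p * kdot p := by
      rw [conserv mass q₃ _ (fun q _ => (h₃ q).trans (hQz q)) ksmd p hp, hkdot]
    have eP := dX_congr_of_pos i (f := fun q => (1/2) * g * (h q)^2
        - (1/3) * h q * (-(dT q₂ q + divSV v q₂ q))) (k := P)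
      (fun q hq => by
        simp only [e₂ q hq, hP]
        ring) hp
    rw [eP, e₂ p hp, e₃, hR]
    ring
  have square : (∀ p : SpT d, 0 < p.2 → dT h p + divF Q p = 0) → ∀ q₁ : SpT d → ℝ,
      (∀ p : SpT d, q₁ p = (h p)^2) → ∀ p : SpT d, 0 < p.2 →
      dT q₁ p + divSV v q₁ p = h p * hdot p := by
    intro mass q₁ h₁ p hp
    rw [conserv mass q₁ h (fun q _ => (h₁ q).trans (sq _)) hsmd p hp, hhdot]
  constructor
  · rintro ⟨mass, mom⟩
    refine ⟨fun p => (h p)^2, fun p => h p * (hdot p + 3 / 2 * advZ v z p),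
      fun p => ∑ i, Q p i * dZ i z p.1, hsm.pow 2, hsm.mul (hdsm.add (contDiff_const.mul ksm)),
      ?_, mass, fun p hp i => ?_, fun p hp => ?_, fun _ => rfl, fun _ => rfl⟩
    · rw [funext hQz]
      exact hsm.mul ksm
    · rw [add_assoc, momentum mass _ _ (fun _ _ => rfl) (fun _ => rfl) p hp i, ← add_assoc]
      exact mom p hp i
    · rw [square mass _ (fun _ => rfl) p hp]
      simp only [hQz]
      ring
  · rintro ⟨q₁, q₂, q₃, -, -, -, mass, mom, rel, h₁, h₃⟩
    refine ⟨mass, fun p hp i => ?_⟩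
    have h₂ : ∀ p : SpT d, 0 < p.2 → q₂ p = h p * (hdot p + 3 / 2 * advZ v z p) :=
      fun p hp => by
        have hr := rel p hp
        rw [square mass q₁ h₁ p hp, h₃, hQz] at hr
        linear_combination -hr
    rw [add_assoc, ← momentum mass q₂ q₃ h₂ h₃ p hp i, ← add_assoc]
    exact mom p hp i
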